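/- Let X_1,…,X_K be mutually independent finitely-valued random variables and let (X_1,…,X_K,Z) be jointly distributed, with 𝒦 = {1,…,K}. Then for all disjoint subsets A, B ⊆ 𝒦, I(X_{A∪B};Z) ≥ I(X_A;Z) + I(X_B;Z). -/

import Mathlib

open scoped Classical

noncomputable section

/-- Probability that random variable `X` takes value `x`, under pmf `p` on a finite sample space. -/
def probOf {Ω α : Type} [Fintype Ω] (p : Ω → ℝ) (X : Ω → α) (x : α) : ℝ :=
  ∑ ω, if X ω = x then p ω else 0

/-- Shannon entropy of a finitely-valued random variable. -/
def Hent {Ω α : Type} [Fintype Ω] [Fintype α] (p : Ω → ℝ) (X : Ω → α) : ℝ :=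
  -∑ x, probOf p X x * Real.log (probOf p X x)

/-- Conditional entropy `H(X | C)`. -/
def condHent {Ω α γ : Type} [Fintype Ω] [Fintype α] [Fintype γ]
    (p : Ω → ℝ) (X : Ω → α) (C : Ω → γ) : ℝ :=
  Hent p (fun ω => (X ω, C ω)) - Hent p C

/-- Conditional mutual information `I(A;B | C)`. -/
def IcondMut {Ω α β γ : Type} [Fintype Ω] [Fintype α] [Fintype β] [Fintype γ]
    (p : Ω → ℝ) (A : Ω → α) (B : Ω → β) (C : Ω → γ) : ℝ :=
  condHent p A C + condHent p B C - condHent p (fun ω => (A ω, B ω)) C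

/-- Mutual information `I(A;B)`. -/
def Imut {Ω α β : Type} [Fintype Ω] [Fintype α] [Fintype β]
    (p : Ω → ℝ) (A : Ω → α) (B : Ω → β) : ℝ :=
  Hent p A + Hent p B - Hent p (fun ω => (A ω, B ω))

/-- `p` is a probability mass function. -/
def IsPMF {Ω : Type} [Fintype Ω] (p : Ω → ℝ) : Prop :=
  (∀ ω, 0 ≤ p ω) ∧ ∑ ω, p ω = 1

/-- The tuple `X_S = (X_k)_{k ∈ S}` as a random variable. -/
def tup {Ω ι : Type} {𝒳 : ι → Type} (X : ∀ k, Ω → 𝒳 k) (S : Finset ι) :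
    Ω → ∀ k : S, 𝒳 k.1 :=
  fun ω k => X k.1 ω

/-- The random variables `X_1, …, X_K` are mutually independent. -/
def MutIndep {Ω ι : Type} [Fintype Ω] [Fintype ι] {𝒳 : ι → Type} [∀ k, Fintype (𝒳 k)]
    (p : Ω → ℝ) (X : ∀ k, Ω → 𝒳 k) : Prop :=
  ∀ x : ∀ k, 𝒳 k, probOf p (fun ω k => X k ω) x = ∏ k, probOf p (X k) (x k)

section Entropy

variable {Ω α β γ : Type} [Fintype Ω]

theorem probOf_nonneg {p : Ω → ℝ} (hp : ∀ ω, 0 ≤ p ω) (X : Ω → α) (x : α) :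
    0 ≤ probOf p X x :=
  Finset.sum_nonneg fun ω _ => by split_ifs <;> simp [hp ω]

theorem probOf_apply_pos {p : Ω → ℝ} (hp : ∀ ω, 0 ≤ p ω) (X : Ω → α) {ω : Ω} (hω : 0 < p ω) :
    0 < probOf p X (X ω) := by
  refine Finset.sum_pos' (fun ω' _ => ?_) ⟨ω, Finset.mem_univ ω, by simpa using hω⟩
  split_ifs <;> simp [hp ω']

/-- The expectation of a function of `X` is the sum of its values weighted by the law of `X`. -/
theorem sum_probOf_mul [Fintype α] (p : Ω → ℝ) (X : Ω → α) (f : α → ℝ) :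
    ∑ x, probOf p X x * f x = ∑ ω, p ω * f (X ω) := by
  simp only [probOf, Finset.sum_mul, ite_mul, zero_mul]
  rw [Finset.sum_comm]
  simp

theorem sum_probOf [Fintype α] (p : Ω → ℝ) (X : Ω → α) : ∑ x, probOf p X x = ∑ ω, p ω := by
  simpa using sum_probOf_mul p X fun _ => 1

theorem sum_probOf_prod [Fintype α] (p : Ω → ℝ) (X : Ω → α) (Y : Ω → β) (y : β) :
    ∑ x, probOf p (fun ω => (X ω, Y ω)) (x, y) = probOf p Y y := by
  simp only [probOf, Prod.mk.injEq, ite_and]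
  rw [Finset.sum_comm]
  simp

theorem Hent_eq_sum [Fintype α] (p : Ω → ℝ) (X : Ω → α) :
    Hent p X = -∑ ω, p ω * Real.log (probOf p X (X ω)) := by
  rw [Hent, sum_probOf_mul p X fun x => Real.log (probOf p X x)]

/-- Entropy depends only on the partition of the sample space induced by the random variable. -/
theorem Hent_congr [Fintype α] [Fintype β] (p : Ω → ℝ) (X : Ω → α) (Y : Ω → β)
    (h : ∀ ω ω', X ω = X ω' ↔ Y ω = Y ω') : Hent p X = Hent p Y := by
  simp only [Hent_eq_sum, probOf, h]

/-- Submodularity of entropy, i.e. nonnegativity of conditional mutual information. -/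
theorem Hent_submodular [Fintype α] [Fintype β] [Fintype γ] {p : Ω → ℝ} (hp : ∀ ω, 0 ≤ p ω)
    (X : Ω → α) (Y : Ω → β) (Z : Ω → γ) :
    Hent p (fun ω => (X ω, Y ω, Z ω)) + Hent p Z ≤
      Hent p (fun ω => (X ω, Z ω)) + Hent p (fun ω => (Y ω, Z ω)) := by
  set P := probOf p (fun ω => (X ω, Y ω, Z ω))
  set Q := probOf p (fun ω => (X ω, Z ω)) with hQ
  set R := probOf p (fun ω => (Y ω, Z ω)) with hR
  set S := probOf p Z
  have hQ0 : ∀ v, 0 ≤ Q v := probOf_nonneg hp _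
  have hR0 : ∀ v, 0 ≤ R v := probOf_nonneg hp _
  have hS0 : ∀ v, 0 ≤ S v := probOf_nonneg hp _
  have pointwise : ∀ ω, p ω * (Real.log (Q (X ω, Z ω)) + Real.log (R (Y ω, Z ω))
      - Real.log (P (X ω, Y ω, Z ω)) - Real.log (S (Z ω))) ≤
      p ω * (Q (X ω, Z ω) * R (Y ω, Z ω) / (P (X ω, Y ω, Z ω) * S (Z ω))) - p ω := by
    intro ω
    rcases (hp ω).eq_or_lt with h | h
    · simp [← h]
    have hq : 0 < Q (X ω, Z ω) := probOf_apply_pos hp (fun ω => (X ω, Z ω)) h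
    have hr : 0 < R (Y ω, Z ω) := probOf_apply_pos hp (fun ω => (Y ω, Z ω)) h
    have hP : 0 < P (X ω, Y ω, Z ω) := probOf_apply_pos hp (fun ω => (X ω, Y ω, Z ω)) h
    have hs : 0 < S (Z ω) := probOf_apply_pos hp Z h
    have hlog := Real.log_le_sub_one_of_pos (div_pos (mul_pos hq hr) (mul_pos hP hs))
    rw [Real.log_div (by positivity) (by positivity), Real.log_mul hq.ne' hr.ne',
      Real.log_mul hP.ne' hs.ne'] at hlog
    nlinarith
  have hle : ∑ ω, p ω * (Q (X ω, Z ω) * R (Y ω, Z ω) / (P (X ω, Y ω, Z ω) * S (Z ω))) ≤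
      ∑ ω, p ω := by
    rw [← sum_probOf_mul p (fun ω => (X ω, Y ω, Z ω))
      fun v => Q (v.1, v.2.2) * R (v.2.1, v.2.2) / (P v * S v.2.2)]
    calc ∑ v, P v * (Q (v.1, v.2.2) * R (v.2.1, v.2.2) / (P v * S v.2.2))
        ≤ ∑ v : α × β × γ, Q (v.1, v.2.2) * R (v.2.1, v.2.2) / S v.2.2 := by
          refine Finset.sum_le_sum fun v _ => ?_
          by_cases h : P v = 0
          · rw [h, zero_mul]
            exact div_nonneg (mul_nonneg (hQ0 _) (hR0 _)) (hS0 _)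
          · rw [mul_div_assoc', mul_div_mul_left _ _ h]
      _ = ∑ z, (∑ x, Q (x, z)) * (∑ y, R (y, z)) / S z := by
          simp only [Fintype.sum_prod_type, Finset.sum_mul_sum, Finset.sum_div]
          rw [Finset.sum_congr rfl fun x _ => Finset.sum_comm, Finset.sum_comm]
      _ = ∑ z, S z := by
          refine Finset.sum_congr rfl fun z _ => ?_
          rw [hQ, hR, sum_probOf_prod, sum_probOf_prod]
          exact mul_self_div_self _
      _ = ∑ ω, p ω := sum_probOf p Z
  have hsum := Finset.sum_le_sum fun ω (_ : ω ∈ Finset.univ) => pointwise ω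
  simp only [mul_sub, mul_add, Finset.sum_sub_distrib, Finset.sum_add_distrib] at hsum
  simp only [Hent_eq_sum]
  linarith

end Entropy

section Independence

variable {Ω ι : Type} [Fintype Ω] [Fintype ι] {𝒳 : ι → Type} [∀ k, Fintype (𝒳 k)]

/-- The law of a subfamily of mutually independent variables is a product. -/
theorem MutIndep.probOf_tup {p : Ω → ℝ} (hp : IsPMF p) {X : ∀ k, Ω → 𝒳 k} (hind : MutIndep p X)
    (S : Finset ι) (ω₀ : Ω) :
    probOf p (tup X S) (tup X S ω₀) = ∏ k ∈ S, probOf p (X k) (X k ω₀) := by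
  let T : ∀ k, Finset (𝒳 k) := fun k => if k ∈ S then {X k ω₀} else Finset.univ
  have hT : ∀ ω, (tup X S ω = tup X S ω₀) ↔ (fun k => X k ω) ∈ Fintype.piFinset T := by
    intro ω
    simp only [funext_iff, tup, Subtype.forall, Fintype.mem_piFinset, T]
    refine forall_congr' fun k => ?_
    by_cases hk : k ∈ S <;> simp [hk]
  calc probOf p (tup X S) (tup X S ω₀)
      = ∑ x ∈ Fintype.piFinset T, probOf p (fun ω k => X k ω) x := by
        unfold probOf
        rw [Finset.sum_comm]
        refine Finset.sum_congr rfl fun ω _ => ?_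
        simp only [hT]
        convert (Finset.sum_ite_eq (Fintype.piFinset T) (fun k => X k ω) fun _ => p ω).symm
    _ = ∏ k, ∑ x ∈ T k, probOf p (X k) x := by
        rw [Finset.prod_univ_sum]
        exact Finset.sum_congr rfl fun x _ => hind x
    _ = ∏ k, if k ∈ S then probOf p (X k) (X k ω₀) else 1 := by
        refine Finset.prod_congr rfl fun k _ => ?_
        by_cases hk : k ∈ S
        · simp [T, hk]
        · simp [T, hk, sum_probOf, hp.2]
    _ = ∏ k ∈ S, probOf p (X k) (X k ω₀) := by simp

theorem MutIndep.Hent_tup {p : Ω → ℝ} (hp : IsPMF p) {X : ∀ k, Ω → 𝒳 k} (hind : MutIndep p X)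
    (S : Finset ι) [Fintype (∀ k : S, 𝒳 k.1)] : Hent p (tup X S) = ∑ k ∈ S, Hent p (X k) := by
  simp only [Hent_eq_sum, hind.probOf_tup hp, Finset.sum_neg_distrib]
  rw [Finset.sum_comm]
  congr 1
  refine Finset.sum_congr rfl fun ω _ => ?_
  rcases (hp.1 ω).eq_or_lt with h | h
  · simp [← h]
  · rw [Real.log_prod fun k _ => (probOf_apply_pos hp.1 (X k) h).ne', Finset.mul_sum]

end Independence

theorem stmt19 {K : ℕ} (hK : 1 ≤ K) {Ω : Type} [Fintype Ω]
    {𝒳 : Fin K → Type} [∀ k, Fintype (𝒳 k)] {𝒵 : Type} [Fintype 𝒵]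
    (p : Ω → ℝ) (hp : IsPMF p)
    (X : ∀ k, Ω → 𝒳 k) (Z : Ω → 𝒵) (hind : MutIndep p X)
    (A B : Finset (Fin K)) (hAB : Disjoint A B) :
    Imut p (tup X A) Z + Imut p (tup X B) Z ≤ Imut p (tup X (A ∪ B)) Z := by
  have hent : Hent p (tup X (A ∪ B)) = Hent p (tup X A) + Hent p (tup X B) := by
    rw [hind.Hent_tup hp, hind.Hent_tup hp, hind.Hent_tup hp, ← Finset.sum_union hAB]
  have hjoint : Hent p (fun ω => (tup X (A ∪ B) ω, Z ω)) =
      Hent p (fun ω => (tup X A ω, tup X B ω, Z ω)) := by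
    refine Hent_congr p _ _ fun ω ω' => ?_
    simp only [Prod.mk.injEq, funext_iff, tup, Subtype.forall, Finset.mem_union, or_imp,
      forall_and, and_assoc]
  have hsub := Hent_submodular hp.1 (tup X A) (tup X B) Z
  simp only [Imut]
  linarith
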